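/- Assume conditions (1.2) and (2.1), suppose 1/r ∈ L₁(ℝ), and let u, v be a principal fundamental system of solutions of (r z')' = q z. Define θ(x) = |x| · (∫_{-∞}^x dt/r(t)) · (∫_x^∞ dt/r(t)). If sup_{x∈ℝ} θ(x) < ∞, then for every p ∈ (1,∞) the Green operator G is bounded on L_p(ℝ); if moreover θ(x) → 0 as |x| → ∞, then G : L_p(ℝ) → L_p(ℝ) is compact for every p ∈ (1,∞). -/

import Mathlib

open MeasureTheory Filter Topology
open scoped ENNReal RealInnerProductSpace

noncomputable section

/-- Conditions (1.2): `r, q` measurable, `r > 0`, `q ≥ 0`, with `1/r` and `q`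
locally Lebesgue integrable on `ℝ`. -/
def Cond12 (r q : ℝ → ℝ) : Prop :=
  Measurable r ∧ Measurable q ∧ (∀ x, 0 < r x) ∧ (∀ x, 0 ≤ q x) ∧
    LocallyIntegrable (fun t => 1 / r t) volume ∧ LocallyIntegrable q volume

/-- Condition (1.3): for every `x`,
`(∫_{x-d}^x dt/r(t)) · (∫_{x-d}^x q(t) dt) → ∞` as `|d| → ∞`. -/
def Cond13 (r q : ℝ → ℝ) : Prop :=
  ∀ x : ℝ, Tendsto (fun d : ℝ => (∫ t in x - d..x, 1 / r t) * (∫ t in x - d..x, q t))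
    (cocompact ℝ) atTop

/-- Condition (2.1): `∫_{-∞}^x q > 0` and `∫_x^∞ q > 0` for every `x`. -/
def Cond21 (q : ℝ → ℝ) : Prop :=
  ∀ x : ℝ, 0 < ∫⁻ t in Set.Iic x, ENNReal.ofReal (q t) ∧
    0 < ∫⁻ t in Set.Ici x, ENNReal.ofReal (q t)

/-- A principal fundamental system of solutions `u, v` (with a.e. derivatives
`u', v'`) of the equation `(r z')' = q z`:  `u, v, r u', r v'` are locally
absolutely continuous (expressed through the integral identities below),
`(r u')' = q u` and `(r v')' = q v` a.e., `u > 0`, `v > 0`, `v' ≥ 0`, `u' ≤ 0`,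
`r (v' u - u' v) ≡ 1`, `v/u → 0` at `-∞`, `u/v → 0` at `+∞`,
`∫_{-∞}^0 dt/(r u²) < ∞` and `∫_0^∞ dt/(r v²) < ∞`. -/
structure PFSS (r q u v u' v' : ℝ → ℝ) : Prop where
  u_pos : ∀ x, 0 < u x
  v_pos : ∀ x, 0 < v x
  u'_nonpos : ∀ x, u' x ≤ 0
  v'_nonneg : ∀ x, 0 ≤ v' x
  u'_intble : ∀ a b : ℝ, IntervalIntegrable u' volume a b
  v'_intble : ∀ a b : ℝ, IntervalIntegrable v' volume a b
  u_deriv : ∀ a b : ℝ, u b - u a = ∫ t in a..b, u' t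
  v_deriv : ∀ a b : ℝ, v b - v a = ∫ t in a..b, v' t
  ru'_deriv : ∀ a b : ℝ, r b * u' b - r a * u' a = ∫ t in a..b, q t * u t
  rv'_deriv : ∀ a b : ℝ, r b * v' b - r a * v' a = ∫ t in a..b, q t * v t
  wronskian : ∀ x, r x * (v' x * u x - u' x * v x) = 1
  ratio_bot : Tendsto (fun x => v x / u x) atBot (𝓝 0)
  ratio_top : Tendsto (fun x => u x / v x) atTop (𝓝 0)
  int_u : ∫⁻ t in Set.Iic (0:ℝ), ENNReal.ofReal (1 / (r t * u t ^ 2)) < ⊤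
  int_v : ∫⁻ t in Set.Ici (0:ℝ), ENNReal.ofReal (1 / (r t * v t ^ 2)) < ⊤

/-- The Green kernel `G(x,t) = u(x) v(t)` for `x ≥ t`, `u(t) v(x)` for `x ≤ t`. -/
def greenKernel (u v : ℝ → ℝ) (x t : ℝ) : ℝ :=
  if t ≤ x then u x * v t else u t * v x

/-- The space `L_p(ℝ)` (with respect to Lebesgue measure). -/
abbrev LpR (p : ℝ≥0∞) : Type := Lp ℝ p (volume : Measure ℝ)

/-- `G` is (a bounded realization on `L_p` of) the Green operator
`(G f)(x) = ∫_ℝ G(x,t) f(t) dt`. -/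
def IsGreenOp (u v : ℝ → ℝ) (p : ℝ≥0∞) [Fact (1 ≤ p)]
    (G : LpR p →L[ℝ] LpR p) : Prop :=
  ∀ f : LpR p,
    (G f : ℝ → ℝ) =ᵐ[volume] fun x => ∫ t, greenKernel u v x t * (f : ℝ → ℝ) t

/-- `d₁` solves `(∫_{x-d}^x dt/r)(∫_{x-d}^x q dt) = 1`, `d₁ > 0`. -/
def IsD1 (r q d₁ : ℝ → ℝ) : Prop :=
  ∀ x : ℝ, 0 < d₁ x ∧
    (∫ t in x - d₁ x..x, 1 / r t) * (∫ t in x - d₁ x..x, q t) = 1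

/-- `d₂` solves `(∫_x^{x+d} dt/r)(∫_x^{x+d} q dt) = 1`, `d₂ > 0`. -/
def IsD2 (r q d₂ : ℝ → ℝ) : Prop :=
  ∀ x : ℝ, 0 < d₂ x ∧
    (∫ t in x..x + d₂ x, 1 / r t) * (∫ t in x..x + d₂ x, q t) = 1

/-- `φ(x) = ∫_{x-d₁(x)}^x dt/r(t)`. -/
def phiF (r d₁ : ℝ → ℝ) (x : ℝ) : ℝ := ∫ t in x - d₁ x..x, 1 / r t

/-- `ψ(x) = ∫_x^{x+d₂(x)} dt/r(t)`. -/
def psiF (r d₂ : ℝ → ℝ) (x : ℝ) : ℝ := ∫ t in x..x + d₂ x, 1 / r t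

/-- `h(x) = φ(x)ψ(x)/(φ(x)+ψ(x))`. -/
def hF (r d₁ d₂ : ℝ → ℝ) (x : ℝ) : ℝ :=
  phiF r d₁ x * psiF r d₂ x / (phiF r d₁ x + psiF r d₂ x)

/-- `d` solves `∫_{x-d(x)}^{x+d(x)} dt/(r(t)h(t)) = 1`, `d > 0`. -/
def IsD (r h d : ℝ → ℝ) : Prop :=
  ∀ x : ℝ, 0 < d x ∧ (∫ t in x - d x..x + d x, 1 / (r t * h t)) = 1

/-- `s` solves `∫_{x-s(x)}^{x+s(x)} dt/(r(t)ρ(t)) = 1`, `s > 0`. -/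
def IsS (r ρ s : ℝ → ℝ) : Prop :=
  ∀ x : ℝ, 0 < s x ∧ (∫ t in x - s x..x + s x, 1 / (r t * ρ t)) = 1


/-- **Schur test** with a single weight, for nonnegative kernels on a `σ`-finite space. -/
theorem lintegral_schur_test {α : Type*} [MeasurableSpace α] {μ : Measure α} [SFinite μ]
    {p q : ℝ} (hpq : p.HolderConjugate q) {H : α → α → ℝ≥0∞}
    (hH : Measurable (Function.uncurry H)) {w : α → ℝ≥0∞} (hw : Measurable w)
    (hw0 : ∀ᵐ x ∂μ, w x ≠ 0) (hwt : ∀ᵐ x ∂μ, w x ≠ ⊤) (C : ℝ≥0∞)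
    (hrow : ∀ᵐ x ∂μ, ∫⁻ t, H x t * w t ^ q ∂μ ≤ C * w x ^ q)
    (hcol : ∀ᵐ t ∂μ, ∫⁻ x, H x t * w x ^ p ∂μ ≤ C * w t ^ p)
    {F : α → ℝ≥0∞} (hF : Measurable F) :
    ∫⁻ x, (∫⁻ t, H x t * F t ∂μ) ^ p ∂μ ≤ C ^ (p / q) * C * ∫⁻ t, F t ^ p ∂μ := by
  have hp := hpq.pos
  have hq := hpq.symm.pos
  have hrowm : ∀ x, Measurable (H x) := fun x => hH.of_uncurry_left
  have key : ∀ᵐ x ∂μ, (∫⁻ t, H x t * F t ∂μ) ^ p ≤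
      C ^ (p / q) * ∫⁻ t, w x ^ p * (H x t * (F t * (w t)⁻¹) ^ p) ∂μ := by
    filter_upwards [hrow] with x hx
    have h1 : ∫⁻ t, H x t * F t ∂μ =
        ∫⁻ t, ((fun t => H x t ^ (1 / q) * w t) * fun t => H x t ^ (1 / p) * (F t * (w t)⁻¹)) t
          ∂μ := by
      refine lintegral_congr_ae ?_
      filter_upwards [hw0, hwt] with t h0 ht
      have e1 : H x t ^ (1 / q) * H x t ^ (1 / p) = H x t := by
        rw [← ENNReal.rpow_add_of_nonneg _ _ (by positivity) (by positivity)]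
        have : 1 / q + 1 / p = 1 := by simpa using hpq.symm.inv_add_inv_eq_one
        rw [this, ENNReal.rpow_one]
      calc H x t * F t
          = (H x t ^ (1 / q) * H x t ^ (1 / p)) * F t * (w t * (w t)⁻¹) := by
            rw [e1, ENNReal.mul_inv_cancel h0 ht, mul_one]
        _ = _ := by simp only [Pi.mul_apply]; ring
    have h2 := ENNReal.lintegral_mul_le_Lp_mul_Lq μ hpq.symm
      (f := fun t => H x t ^ (1 / q) * w t) (g := fun t => H x t ^ (1 / p) * (F t * (w t)⁻¹))
      (by have := hrowm x; fun_prop) (by have := hrowm x; fun_prop)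
    rw [← h1] at h2
    have h3 : ∫⁻ t, (H x t ^ (1 / q) * w t) ^ q ∂μ = ∫⁻ t, H x t * w t ^ q ∂μ := by
      refine lintegral_congr fun t => ?_
      rw [ENNReal.mul_rpow_of_nonneg _ _ hq.le, ← ENNReal.rpow_mul, one_div_mul_cancel hq.ne',
        ENNReal.rpow_one]
    have h4 : ∫⁻ t, (H x t ^ (1 / p) * (F t * (w t)⁻¹)) ^ p ∂μ =
        ∫⁻ t, H x t * (F t * (w t)⁻¹) ^ p ∂μ := by
      refine lintegral_congr fun t => ?_
      rw [ENNReal.mul_rpow_of_nonneg _ _ hp.le, ← ENNReal.rpow_mul, one_div_mul_cancel hp.ne',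
        ENNReal.rpow_one]
    rw [h3, h4] at h2
    calc (∫⁻ t, H x t * F t ∂μ) ^ p
        ≤ ((C * w x ^ q) ^ (1 / q) * (∫⁻ t, H x t * (F t * (w t)⁻¹) ^ p ∂μ) ^ (1 / p)) ^ p := by
          gcongr
          exact h2.trans (by gcongr)
      _ = C ^ (p / q) * (w x ^ p * ∫⁻ t, H x t * (F t * (w t)⁻¹) ^ p ∂μ) := by
          rw [ENNReal.mul_rpow_of_nonneg _ _ hp.le, ← ENNReal.rpow_mul, ← ENNReal.rpow_mul,
            one_div_mul_cancel hp.ne', ENNReal.rpow_one,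
            ENNReal.mul_rpow_of_nonneg _ _ (by positivity), ← ENNReal.rpow_mul (w x), mul_assoc,
            show 1 / q * p = p / q by ring, show q * (p / q) = p by field_simp]
      _ = _ := by
          rw [lintegral_const_mul]
          have := hrowm x
          fun_prop
  have hmeas : Measurable (Function.uncurry
      fun x t => w x ^ p * (H x t * (F t * (w t)⁻¹) ^ p)) := by
    have : (Function.uncurry fun x t => w x ^ p * (H x t * (F t * (w t)⁻¹) ^ p)) =
      fun z : α × α => w z.1 ^ p * (Function.uncurry H z * (F z.2 * (w z.2)⁻¹) ^ p) := rfl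
    rw [this]
    fun_prop
  calc ∫⁻ x, (∫⁻ t, H x t * F t ∂μ) ^ p ∂μ
      ≤ ∫⁻ x, C ^ (p / q) * ∫⁻ t, w x ^ p * (H x t * (F t * (w t)⁻¹) ^ p) ∂μ ∂μ :=
        lintegral_mono_ae key
    _ = C ^ (p / q) * ∫⁻ t, ∫⁻ x, w x ^ p * (H x t * (F t * (w t)⁻¹) ^ p) ∂μ ∂μ := by
        rw [lintegral_const_mul _ hmeas.lintegral_prod_right,
          lintegral_lintegral_swap hmeas.aemeasurable]
    _ ≤ C ^ (p / q) * ∫⁻ t, C * F t ^ p ∂μ := by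
        gcongr 1
        refine lintegral_mono_ae ?_
        filter_upwards [hcol, hw0, hwt] with t hc h0 ht
        have hcolm : Measurable fun x => H x t := hH.of_uncurry_right
        calc ∫⁻ x, w x ^ p * (H x t * (F t * (w t)⁻¹) ^ p) ∂μ
            = (∫⁻ x, H x t * w x ^ p ∂μ) * (F t * (w t)⁻¹) ^ p := by
              rw [← lintegral_mul_const _ (by fun_prop)]
              exact lintegral_congr fun x => by ring
          _ ≤ C * w t ^ p * (F t * (w t)⁻¹) ^ p := by gcongr
          _ = C * (w t * (F t * (w t)⁻¹)) ^ p := by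
              rw [ENNReal.mul_rpow_of_nonneg (w t) _ hp.le, mul_assoc]
          _ = C * F t ^ p := by
              rw [mul_left_comm, ENNReal.mul_inv_cancel h0 ht, mul_one]
    _ = _ := by rw [lintegral_const_mul _ (by fun_prop), mul_assoc]

/-- The kernel `1 / max |x| |t|`, homogeneous of degree `-1`. -/
def hardyKernel (x t : ℝ) : ℝ≥0∞ := (ENNReal.ofReal (max |x| |t|))⁻¹

theorem measurable_hardyKernel : Measurable (Function.uncurry hardyKernel) := by
  have : Function.uncurry hardyKernel =
    fun z : ℝ × ℝ => (ENNReal.ofReal (max |z.1| |z.2|))⁻¹ := rfl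
  rw [this]
  fun_prop

theorem hardyKernel_comm (x t : ℝ) : hardyKernel x t = hardyKernel t x := by
  simp only [hardyKernel, max_comm]

theorem lintegral_comp_abs (g : ℝ → ℝ≥0∞) :
    ∫⁻ t, g |t| = 2 * ∫⁻ t in Set.Ioi (0 : ℝ), g t := by
  have h1 : ∫⁻ t in Set.Ioi (0 : ℝ), g |t| = ∫⁻ t in Set.Ioi (0 : ℝ), g t :=
    setLIntegral_congr_fun measurableSet_Ioi fun t ht => by
      simp only [abs_of_pos (Set.mem_Ioi.1 ht)]
  have h2 : ∫⁻ t in Set.Iio (0 : ℝ), g |t| = ∫⁻ t in Set.Ioi (0 : ℝ), g t := by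
    rw [← h1]
    have := (Measure.measurePreserving_neg (volume : Measure ℝ)).setLIntegral_comp_preimage_emb
      (Homeomorph.neg ℝ).measurableEmbedding (fun t => g |t|) (Set.Ioi (0 : ℝ))
    simpa using this
  rw [← lintegral_add_compl _ (measurableSet_Ioi (a := (0 : ℝ))), Set.compl_Ioi,
    setLIntegral_congr Iio_ae_eq_Iic.symm, h1, h2, two_mul]

/-- Power weights are eigenfunctions of the kernel `1 / max |x| |t|`. -/
theorem lintegral_hardyKernel_mul_rpow {s : ℝ} (h0 : 0 < s) (h1 : s < 1) {x : ℝ} (hx : x ≠ 0) :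
    ∫⁻ t, hardyKernel x t * ENNReal.ofReal |t| ^ (-s) ≤
      ENNReal.ofReal (2 * (1 / s + 1 / (1 - s))) * ENNReal.ofReal |x| ^ (-s) := by
  have ha : 0 < |x| := abs_pos.2 hx
  set a := |x|
  have e : ∫⁻ t, hardyKernel x t * ENNReal.ofReal |t| ^ (-s) = _ :=
    lintegral_comp_abs fun t => (ENNReal.ofReal (max a t))⁻¹ * ENNReal.ofReal t ^ (-s)
  rw [e, ← Set.Ioc_union_Ioi_eq_Ioi ha.le,
    lintegral_union measurableSet_Ioi (Set.Ioc_disjoint_Ioi le_rfl)]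
  have i1 : ∫⁻ t in Set.Ioc 0 a, (ENNReal.ofReal (max a t))⁻¹ * ENNReal.ofReal t ^ (-s) =
      ENNReal.ofReal (1 / (1 - s) * a ^ (-s)) := by
    have hint : IntegrableOn (fun t : ℝ => a⁻¹ * t ^ (-s)) (Set.Ioc 0 a) :=
      ((intervalIntegrable_iff_integrableOn_Ioc_of_le ha.le).1
        (intervalIntegral.intervalIntegrable_rpow' (by linarith))).const_mul _
    have hval : ∫ t in Set.Ioc 0 a, a⁻¹ * t ^ (-s) = 1 / (1 - s) * a ^ (-s) := by
      rw [integral_const_mul, ← intervalIntegral.integral_of_le ha.le,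
        integral_rpow (Or.inl (by linarith)), Real.zero_rpow (by linarith),
        Real.rpow_add ha, Real.rpow_one]
      have : -s + 1 ≠ 0 := by linarith
      have : 1 - s ≠ 0 := by linarith
      field_simp
      ring
    rw [← hval, ofReal_integral_eq_lintegral_ofReal hint
      ((ae_restrict_mem measurableSet_Ioc).mono fun t ht => by
        have := ht.1; simp only [Pi.zero_apply]; positivity)]
    refine setLIntegral_congr_fun measurableSet_Ioc fun t ht => ?_
    rw [max_eq_left ht.2, ENNReal.ofReal_mul (by positivity), ENNReal.ofReal_inv_of_pos ha,
      ENNReal.ofReal_rpow_of_pos ht.1]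
  have i2 : ∫⁻ t in Set.Ioi a, (ENNReal.ofReal (max a t))⁻¹ * ENNReal.ofReal t ^ (-s) =
      ENNReal.ofReal (1 / s * a ^ (-s)) := by
    have hval : ∫ t in Set.Ioi a, t ^ (-s - 1) = 1 / s * a ^ (-s) := by
      rw [integral_Ioi_rpow_of_lt (by linarith) ha]
      simp only [sub_add_cancel]
      field_simp
    rw [← hval, ofReal_integral_eq_lintegral_ofReal
      (integrableOn_Ioi_rpow_of_lt (by linarith) ha)
      ((ae_restrict_mem measurableSet_Ioi).mono fun t ht => by
        have := ha.trans ht; simp only [Pi.zero_apply]; positivity)]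
    refine setLIntegral_congr_fun measurableSet_Ioi fun t ht => ?_
    have ht0 : 0 < t := ha.trans ht
    rw [max_eq_right (Set.mem_Ioi.1 ht).le, Real.rpow_sub_one ht0.ne', div_eq_inv_mul,
      ENNReal.ofReal_mul (by positivity), ENNReal.ofReal_inv_of_pos ht0,
      ENNReal.ofReal_rpow_of_pos ht0]
  have hs : 0 < 1 - s := by linarith
  rw [i1, i2, ← ENNReal.ofReal_add (by positivity) (by positivity), ENNReal.ofReal_rpow_of_pos ha,
    ← ENNReal.ofReal_mul (by positivity), ← ENNReal.ofReal_ofNat 2,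
    ← ENNReal.ofReal_mul (by positivity)]
  apply le_of_eq
  congr 1
  ring

/-- **Hardy's inequality** for the kernel `1 / max |x| |t|` on the line. -/
theorem exists_lintegral_hardyKernel_le {p : ℝ} (hp : 1 < p) :
    ∃ C : ℝ≥0∞, C ≠ ⊤ ∧ ∀ F : ℝ → ℝ≥0∞, Measurable F →
      ∫⁻ x, (∫⁻ t, hardyKernel x t * F t) ^ p ≤ C * ∫⁻ t, F t ^ p := by
  have hpq := Real.HolderConjugate.conjExponent hp
  set q := p.conjExponent
  have hp0 := hpq.pos
  have hq0 := hpq.symm.pos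
  have hq1 : 1 < q := hpq.symm.lt
  have hsum : 1 / p + 1 / q = 1 := by simpa using hpq.inv_add_inv_eq_one
  set C := ENNReal.ofReal (2 * (1 / (1 / p) + 1 / (1 - 1 / p))) with hC
  have hC' : C = ENNReal.ofReal (2 * (1 / (1 / q) + 1 / (1 - 1 / q))) := by
    rw [hC, show 1 - 1 / p = 1 / q by linarith, show 1 - 1 / q = 1 / p by linarith, add_comm]
  have hne : ∀ᵐ x : ℝ, x ≠ 0 := by simp [ae_iff]
  let w : ℝ → ℝ≥0∞ := fun t => ENNReal.ofReal |t| ^ (-(1 / (p * q)))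
  have hwq : ∀ t, w t ^ q = ENNReal.ofReal |t| ^ (-(1 / p)) := fun t => by
    rw [← ENNReal.rpow_mul]; congr 1; field_simp
  have hwp : ∀ t, w t ^ p = ENNReal.ofReal |t| ^ (-(1 / q)) := fun t => by
    rw [← ENNReal.rpow_mul]; congr 1; field_simp
  refine ⟨C ^ (p / q) * C, ENNReal.mul_ne_top
    (ENNReal.rpow_ne_top_of_nonneg (by positivity) ENNReal.ofReal_ne_top)
    ENNReal.ofReal_ne_top, fun F hF => ?_⟩
  refine lintegral_schur_test hpq measurable_hardyKernel (w := w) (by fun_prop) ?_ ?_ C ?_ ?_ hF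
  · exact .of_forall fun x => by
      simp [w, ENNReal.rpow_eq_zero_iff]
      intros; positivity
  · filter_upwards [hne] with x hx
    simp [w, ENNReal.rpow_eq_top_iff, hx]
  · filter_upwards [hne] with x hx
    simp_rw [hwq]
    exact lintegral_hardyKernel_mul_rpow (by positivity) ((div_lt_one hp0).2 hp) hx
  · filter_upwards [hne] with x hx
    simp_rw [hwp, hardyKernel_comm _ x, hC']
    exact lintegral_hardyKernel_mul_rpow (by positivity) ((div_lt_one hq0).2 hq1) hx

/-- `T` is the integral operator on `L_p(ℝ)` with kernel `k`. -/
def IsKernelOp (k : ℝ → ℝ → ℝ) (p : ℝ≥0∞) [Fact (1 ≤ p)] (T : LpR p →L[ℝ] LpR p) : Prop :=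
  ∀ f : LpR p, (T f : ℝ → ℝ) =ᵐ[volume] fun x => ∫ t, k x t * (f : ℝ → ℝ) t

/-- The kernel `k` is measurable and bounded by `ε / max |x| |t|`. -/
structure HardyBound (k : ℝ → ℝ → ℝ) (ε : ℝ) : Prop where
  measurable : Measurable (Function.uncurry k)
  bound : ∀ x t, |k x t| * max |x| |t| ≤ ε

namespace HardyBound

variable {k k' : ℝ → ℝ → ℝ} {ε ε' : ℝ} {p : ℝ≥0∞}

theorem nonneg (hk : HardyBound k ε) : 0 ≤ ε := by
  simpa using hk.bound 0 0

theorem enorm_le (hk : HardyBound k ε) {x : ℝ} (hx : x ≠ 0) (t : ℝ) :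
    ‖k x t‖ₑ ≤ ENNReal.ofReal ε * hardyKernel x t := by
  have hm : 0 < max |x| |t| := (abs_pos.2 hx).trans_le (le_max_left _ _)
  rw [hardyKernel, ← div_eq_mul_inv, ← ENNReal.ofReal_div_of_pos hm, Real.enorm_eq_ofReal_abs]
  exact ENNReal.ofReal_le_ofReal ((le_div_iff₀ hm).2 (hk.bound x t))

theorem exists_lintegral_le {p : ℝ} (hp : 1 < p) :
    ∃ C : ℝ≥0∞, C ≠ ⊤ ∧ ∀ (k : ℝ → ℝ → ℝ) (ε : ℝ), HardyBound k ε →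
      ∀ f : ℝ → ℝ, Measurable f →
        ∫⁻ x, (∫⁻ t, ‖k x t * f t‖ₑ) ^ p ≤ ENNReal.ofReal ε ^ p * C * ∫⁻ t, ‖f t‖ₑ ^ p := by
  obtain ⟨C, hC, h⟩ := exists_lintegral_hardyKernel_le hp
  refine ⟨C, hC, fun k ε hk f hf => ?_⟩
  have hp0 : 0 < p := by linarith
  have hne : ∀ᵐ x : ℝ, x ≠ 0 := by simp [ae_iff]
  have hm : Measurable fun x => ∫⁻ t, hardyKernel x t * ‖f t‖ₑ := by
    refine Measurable.lintegral_prod_right'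
      (f := fun z : ℝ × ℝ => hardyKernel z.1 z.2 * ‖f z.2‖ₑ) ?_
    exact measurable_hardyKernel.mul (by fun_prop)
  calc ∫⁻ x, (∫⁻ t, ‖k x t * f t‖ₑ) ^ p
      ≤ ∫⁻ x, ENNReal.ofReal ε ^ p * (∫⁻ t, hardyKernel x t * ‖f t‖ₑ) ^ p := by
        refine lintegral_mono_ae ?_
        filter_upwards [hne] with x hx
        rw [← ENNReal.mul_rpow_of_nonneg _ _ hp0.le,
          ← lintegral_const_mul' _ _ ENNReal.ofReal_ne_top]
        gcongr with t
        rw [enorm_mul, ← mul_assoc]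
        gcongr
        exact hk.enorm_le hx t
    _ ≤ _ := by
        rw [lintegral_const_mul _ (by fun_prop), mul_assoc]
        gcongr
        exact h _ (by fun_prop)

theorem ae_integrable (hk : HardyBound k ε) (hp1 : 1 < p) (hp2 : p ≠ ⊤) (f : LpR p) :
    ∀ᵐ x, Integrable fun t => k x t * (f : ℝ → ℝ) t := by
  have hp : 1 < p.toReal := by simpa using (ENNReal.toReal_lt_toReal ENNReal.one_ne_top hp2).2 hp1
  have hp0 : 0 < p.toReal := by linarith
  obtain ⟨C, hC, h⟩ := exists_lintegral_le hp
  have hf := (Lp.stronglyMeasurable f).measurable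
  have hkf : Measurable fun z : ℝ × ℝ => k z.1 z.2 * (f : ℝ → ℝ) z.2 :=
    hk.measurable.mul (by fun_prop)
  have hlt : ∫⁻ x, (∫⁻ t, ‖k x t * (f : ℝ → ℝ) t‖ₑ) ^ p.toReal ≠ ⊤ := by
    refine ((h k ε hk f hf).trans_lt (ENNReal.mul_lt_top (ENNReal.mul_lt_top ?_ hC.lt_top) ?_)).ne
    · exact ENNReal.rpow_lt_top_of_nonneg hp0.le ENNReal.ofReal_ne_top
    · exact lintegral_rpow_enorm_lt_top_of_eLpNorm_lt_top (by positivity) hp2 (Lp.eLpNorm_lt_top f)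
  have hm : Measurable fun x => ∫⁻ t, ‖k x t * (f : ℝ → ℝ) t‖ₑ :=
    Measurable.lintegral_prod_right' (f := fun z : ℝ × ℝ => ‖k z.1 z.2 * (f : ℝ → ℝ) z.2‖ₑ)
      hkf.enorm
  filter_upwards [ae_lt_top (by fun_prop) hlt] with x hx
  refine ⟨?_, ?_⟩
  · exact (hkf.comp measurable_prodMk_left).aestronglyMeasurable
  · exact (ENNReal.rpow_lt_top_iff_of_pos hp0).1 hx

/-- Kernels bounded by `ε / max |x| |t|` define bounded operators on `L_p(ℝ)`, with norm
proportional to `ε`. -/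
theorem exists_isKernelOp (hp1 : 1 < p) (hp2 : p ≠ ⊤) [Fact (1 ≤ p)] :
    ∃ C : ℝ, 0 ≤ C ∧ ∀ (k : ℝ → ℝ → ℝ) (ε : ℝ), HardyBound k ε →
      ∃ T : LpR p →L[ℝ] LpR p, IsKernelOp k p T ∧ ‖T‖ ≤ C * ε := by
  have hp : 1 < p.toReal := by simpa using (ENNReal.toReal_lt_toReal ENNReal.one_ne_top hp2).2 hp1
  have hp0 : 0 < p.toReal := by linarith
  have hp00 : p ≠ 0 := (zero_lt_one.trans hp1).ne'
  obtain ⟨C, hC, h⟩ := exists_lintegral_le hp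
  have hCp : C ^ (1 / p.toReal) ≠ ⊤ := ENNReal.rpow_ne_top_of_nonneg (by positivity) hC
  refine ⟨(C ^ (1 / p.toReal)).toReal, ENNReal.toReal_nonneg, fun k ε hk => ?_⟩
  have hbd : ∀ f : LpR p, eLpNorm (fun x => ∫ t, k x t * (f : ℝ → ℝ) t) p volume ≤
      C ^ (1 / p.toReal) * ENNReal.ofReal ε * eLpNorm f p volume := fun f => by
    have hf := (Lp.stronglyMeasurable f).measurable
    rw [eLpNorm_eq_lintegral_rpow_enorm_toReal hp00 hp2,
      eLpNorm_eq_lintegral_rpow_enorm_toReal hp00 hp2]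
    calc (∫⁻ x, ‖∫ t, k x t * (f : ℝ → ℝ) t‖ₑ ^ p.toReal) ^ (1 / p.toReal)
        ≤ (∫⁻ x, (∫⁻ t, ‖k x t * (f : ℝ → ℝ) t‖ₑ) ^ p.toReal) ^ (1 / p.toReal) := by
          gcongr with x
          exact enorm_integral_le_lintegral_enorm _
      _ ≤ (ENNReal.ofReal ε ^ p.toReal * C * ∫⁻ t, ‖(f : ℝ → ℝ) t‖ₑ ^ p.toReal)
            ^ (1 / p.toReal) := by
          gcongr
          exact h k ε hk f hf
      _ = _ := by
          rw [ENNReal.mul_rpow_of_nonneg _ _ (by positivity),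
            ENNReal.mul_rpow_of_nonneg _ _ (by positivity), ← ENNReal.rpow_mul,
            mul_one_div_cancel hp0.ne', ENNReal.rpow_one, mul_comm (ENNReal.ofReal ε)]
  have hmem : ∀ f : LpR p, MemLp (fun x => ∫ t, k x t * (f : ℝ → ℝ) t) p volume := fun f => by
    refine ⟨?_, (hbd f).trans_lt (ENNReal.mul_lt_top
      (ENNReal.mul_lt_top hCp.lt_top ENNReal.ofReal_lt_top) (Lp.eLpNorm_lt_top f))⟩
    have hf := (Lp.stronglyMeasurable f).measurable
    have hkf : Measurable fun z : ℝ × ℝ => k z.1 z.2 * (f : ℝ → ℝ) z.2 :=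
      hk.measurable.mul (by fun_prop)
    exact (StronglyMeasurable.integral_prod_right (f := fun x t => k x t * (f : ℝ → ℝ) t)
      hkf.stronglyMeasurable).aestronglyMeasurable
  let L : LpR p →ₗ[ℝ] LpR p :=
    { toFun := fun f => (hmem f).toLp _
      map_add' := fun f g => by
        rw [← MemLp.toLp_add, MemLp.toLp_eq_toLp_iff]
        filter_upwards [hk.ae_integrable hp1 hp2 f, hk.ae_integrable hp1 hp2 g] with x hx hy
        rw [Pi.add_apply, ← integral_add hx hy]
        refine integral_congr_ae ?_
        filter_upwards [Lp.coeFn_add f g] with t ht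
        rw [ht, Pi.add_apply, mul_add]
      map_smul' := fun c f => by
        rw [RingHom.id_apply, ← MemLp.toLp_const_smul, MemLp.toLp_eq_toLp_iff]
        refine .of_forall fun x => ?_
        rw [Pi.smul_apply, ← integral_smul]
        refine integral_congr_ae ?_
        filter_upwards [Lp.coeFn_smul c f] with t ht
        rw [ht, Pi.smul_apply, smul_eq_mul, smul_eq_mul, mul_left_comm] }
  have hL : ∀ f, ‖L f‖ ≤ (C ^ (1 / p.toReal)).toReal * ε * ‖f‖ := fun f => by
    change ‖(hmem f).toLp _‖ ≤ _
    rw [Lp.norm_toLp, Lp.norm_def]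
    refine (ENNReal.toReal_mono (ENNReal.mul_ne_top (ENNReal.mul_ne_top hCp ENNReal.ofReal_ne_top)
      (Lp.eLpNorm_ne_top f)) (hbd f)).trans_eq ?_
    rw [ENNReal.toReal_mul, ENNReal.toReal_mul, ENNReal.toReal_ofReal hk.nonneg]
  exact ⟨L.mkContinuous _ hL, fun f => (hmem f).coeFn_toLp,
    L.mkContinuous_norm_le (mul_nonneg ENNReal.toReal_nonneg hk.nonneg) hL⟩

/-- Operators whose kernels are close for the bound `1 / max |x| |t|` are close in norm. -/
theorem exists_norm_sub_le (hp1 : 1 < p) (hp2 : p ≠ ⊤) [Fact (1 ≤ p)] :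
    ∃ C : ℝ, 0 ≤ C ∧ ∀ (k k' : ℝ → ℝ → ℝ) (ε₁ ε₂ ε : ℝ), HardyBound k ε₁ → HardyBound k' ε₂ →
      (∀ x t, |k x t - k' x t| * max |x| |t| ≤ ε) → ∀ T T' : LpR p →L[ℝ] LpR p,
        IsKernelOp k p T → IsKernelOp k' p T' → ‖T - T'‖ ≤ C * ε := by
  obtain ⟨C, hC, h⟩ := exists_isKernelOp hp1 hp2
  refine ⟨C, hC, fun k k' ε₁ ε₂ ε hk hk' hε T T' hT hT' => ?_⟩
  obtain ⟨S, hS, hSn⟩ := h (fun x t => k x t - k' x t) ε ⟨hk.measurable.sub hk'.measurable, hε⟩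
  have : T - T' = S := by
    ext1 f
    apply Lp.ext
    filter_upwards [hS f, hT f, hT' f, hk.ae_integrable hp1 hp2 f, hk'.ae_integrable hp1 hp2 f,
      Lp.coeFn_sub (T f) (T' f)] with x h1 h2 h3 h4 h5 h6
    rw [sub_apply, h6, Pi.sub_apply, h1, h2, h3, ← integral_sub h4 h5]
    simp only [sub_mul]
  rwa [this]

end HardyBound

/-- An operator whose range is contained in the span of finitely many vectors is compact. -/
theorem isCompactOperator_of_forall_mem_span {E F : Type*} [NormedAddCommGroup E] [NormedSpace ℝ E]
    [NormedAddCommGroup F] [NormedSpace ℝ F] (T : E →L[ℝ] F) {s : Set F} (hs : s.Finite)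
    (h : ∀ x, T x ∈ Submodule.span ℝ s) : IsCompactOperator T := by
  have := FiniteDimensional.span_of_finite ℝ hs
  have h1 : IsCompactOperator (T.codRestrict (Submodule.span ℝ s) h) :=
    isCompactOperator_of_locallyCompactSpace_dom (T.codRestrict (Submodule.span ℝ s) h)
  exact h1.clm_comp (Submodule.span ℝ s).subtypeL

/-- The truncation of a kernel to the square `[-N, N]²`. -/
def truncKernel (k : ℝ → ℝ → ℝ) (N x t : ℝ) : ℝ :=
  if |x| ≤ N ∧ |t| ≤ N then k x t else 0

theorem measurable_truncKernel {k : ℝ → ℝ → ℝ} (hk : Measurable (Function.uncurry k)) (N : ℝ) :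
    Measurable (Function.uncurry (truncKernel k N)) := by
  refine Measurable.ite (p := fun z : ℝ × ℝ => |z.1| ≤ N ∧ |z.2| ≤ N) ?_ hk measurable_const
  exact (measurableSet_le (f := fun z : ℝ × ℝ => |z.1|) (by fun_prop) measurable_const).inter
    (measurableSet_le (f := fun z : ℝ × ℝ => |z.2|) (by fun_prop) measurable_const)

theorem abs_truncKernel_mul_le {k : ℝ → ℝ → ℝ} {N M : ℝ} (hN : 0 ≤ N) (hM : 0 ≤ M)
    (h : ∀ x t, |x| ≤ N → |t| ≤ N → |k x t| ≤ M) (x t : ℝ) :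
    |truncKernel k N x t| * max |x| |t| ≤ M * N := by
  unfold truncKernel
  split_ifs with hx
  · have := h x t hx.1 hx.2
    have := max_le hx.1 hx.2
    gcongr
  · simpa using mul_nonneg hM hN

/-- A truncated kernel depending on `x` through finitely many values only defines an operator of
finite rank. -/
theorem IsKernelOp.isCompactOperator_of_finite {k : ℝ → ℝ → ℝ} {N : ℝ} {g : ℝ → ℝ}
    (hg : Measurable g) (hfin : (g '' {x | |x| ≤ N}).Finite) {p : ℝ≥0∞} [Fact (1 ≤ p)]
    {T : LpR p →L[ℝ] LpR p} (hT : IsKernelOp (truncKernel (fun x t => k (g x) t) N) p T) :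
    IsCompactOperator T := by
  have hset : ∀ y, MeasurableSet ({x | |x| ≤ N} ∩ g ⁻¹' {y}) := fun y =>
    (measurableSet_le (by fun_prop) measurable_const).inter (hg (measurableSet_singleton y))
  have hvol : ∀ y, volume ({x : ℝ | |x| ≤ N} ∩ g ⁻¹' {y}) ≠ ⊤ := fun y => by
    refine ((measure_mono Set.inter_subset_left).trans_lt ?_).ne
    have : {x : ℝ | |x| ≤ N} = Set.Icc (-N) N := by ext; simp [abs_le]
    rw [this]
    exact measure_Icc_lt_top
  let e : ℝ → LpR p := fun y => indicatorConstLp p (hset y) (hvol y) 1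
  refine isCompactOperator_of_forall_mem_span T (hfin.image e) fun f => ?_
  let c : ℝ → ℝ := fun y => ∫ t, (if |t| ≤ N then k y t else 0) * (f : ℝ → ℝ) t
  have key : T f = ∑ y ∈ hfin.toFinset, c y • e y := by
    apply Lp.ext
    have h1 : ∀ᵐ x, ∀ y ∈ hfin.toFinset, (c y • e y : LpR p) x =
        c y * ({x | |x| ≤ N} ∩ g ⁻¹' {y}).indicator (fun _ => (1 : ℝ)) x := by
      rw [Filter.eventually_all_finset]
      intro y _
      filter_upwards [Lp.coeFn_smul (c y) (e y),
        indicatorConstLp_coeFn (p := p) (hs := hset y) (hμs := hvol y) (c := (1 : ℝ))] with x hx hx'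
      rw [hx, Pi.smul_apply, hx', smul_eq_mul]
    filter_upwards [hT f, h1, Lp.coeFn_finsetSum hfin.toFinset fun y => c y • e y]
      with x hx hx1 hx2
    rw [hx, hx2, Finset.sum_apply, Finset.sum_congr rfl hx1]
    by_cases hxN : |x| ≤ N
    · rw [Finset.sum_eq_single (g x)]
      · simp [truncKernel, hxN, c]
      · intro y _ hy
        simp [hy.symm]
      · intro hn
        exact absurd (hfin.mem_toFinset.2 ⟨x, hxN, rfl⟩) hn
    · simp [truncKernel, hxN]
  rw [key]
  exact Submodule.sum_mem _ fun y hy => Submodule.smul_mem _ _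
    (Submodule.subset_span ⟨y, hfin.mem_toFinset.1 hy, rfl⟩)

/-- A continuous kernel truncated to a square defines a compact operator on `L_p(ℝ)`. -/
theorem exists_isKernelOp_truncKernel {k : ℝ → ℝ → ℝ} (hk : Continuous (Function.uncurry k))
    {N : ℝ} (hN : 0 < N) {p : ℝ≥0∞} (hp1 : 1 < p) (hp2 : p ≠ ⊤) [Fact (1 ≤ p)] :
    (∃ ε, HardyBound (truncKernel k N) ε) ∧
      ∃ T : LpR p →L[ℝ] LpR p, IsKernelOp (truncKernel k N) p T ∧ IsCompactOperator T := by
  set K : Set (ℝ × ℝ) := Set.Icc (-(N + 1)) (N + 1) ×ˢ Set.Icc (-(N + 1)) (N + 1)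
  have hK : IsCompact K := isCompact_Icc.prod isCompact_Icc
  have memK : ∀ {x t : ℝ}, |x| ≤ N + 1 → |t| ≤ N → (x, t) ∈ K := fun hx ht =>
    ⟨abs_le.1 hx, abs_le.1 (ht.trans (by linarith))⟩
  obtain ⟨M, hM⟩ := hK.exists_bound_of_continuousOn hk.continuousOn
  have hM0 : 0 ≤ M := (norm_nonneg _).trans (hM (0, 0) (memK (by simp; linarith) (by simp [hN.le])))
  have hbd : HardyBound (truncKernel k N) (M * N) :=
    ⟨measurable_truncKernel hk.measurable N, abs_truncKernel_mul_le hN.le hM0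
      fun x t hx ht => hM (x, t) (memK (by linarith) ht)⟩
  obtain ⟨C₁, hC₁, hex⟩ := HardyBound.exists_isKernelOp (p := p) hp1 hp2
  obtain ⟨C, hC, hsub⟩ := HardyBound.exists_norm_sub_le (p := p) hp1 hp2
  obtain ⟨T, hT, -⟩ := hex _ _ hbd
  refine ⟨⟨_, hbd⟩, T, hT, ?_⟩
  suffices T ∈ closure {S : LpR p →L[ℝ] LpR p | IsCompactOperator S} by
    rwa [isClosed_setOfPred_isCompactOperator.closure_eq] at this
  rw [Metric.mem_closure_iff]
  intro η hη
  obtain ⟨δ₀, hδ₀, huc⟩ := Metric.uniformContinuousOn_iff_le.1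
    (hK.uniformContinuousOn_of_continuous hk.continuousOn) (η / (2 * (C + 1) * N)) (by positivity)
  set δ := min δ₀ 1
  have hδ : 0 < δ := lt_min hδ₀ one_pos
  let g : ℝ → ℝ := fun x => δ * ⌊x / δ⌋
  have hgm : Measurable g := by
    have : Measurable fun x : ℝ => ((⌊x / δ⌋ : ℤ) : ℝ) :=
      (measurable_of_countable _).comp (Int.measurable_floor.comp (by fun_prop))
    exact this.const_mul δ
  have hg : ∀ x, |x - g x| ≤ δ := fun x => by
    have h1 := Int.floor_le (x / δ)
    have h2 := (Int.lt_floor_add_one (x / δ)).le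
    rw [le_div_iff₀ hδ] at h1
    rw [div_le_iff₀ hδ] at h2
    rw [abs_le]
    constructor <;> simp only [g] <;> nlinarith
  have hgN : ∀ x, |x| ≤ N → |g x| ≤ N + 1 := fun x hx => by
    have h1 := abs_sub_abs_le_abs_sub (g x) x
    rw [abs_sub_comm] at h1
    have := (hg x).trans (min_le_right _ _)
    linarith
  have hfin : (g '' {x | |x| ≤ N}).Finite := by
    refine ((Set.finite_Icc ⌊-N / δ⌋ ⌊N / δ⌋).image fun n : ℤ => δ * (n : ℝ)).subset ?_
    rintro _ ⟨x, hx, rfl⟩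
    obtain ⟨h1, h2⟩ := abs_le.1 (show |x| ≤ N from hx)
    exact ⟨⌊x / δ⌋, ⟨Int.floor_le_floor (by gcongr), Int.floor_le_floor (by gcongr)⟩, rfl⟩
  have hbd' : HardyBound (truncKernel (fun x t => k (g x) t) N) (M * N) := by
    refine ⟨measurable_truncKernel ?_ N, abs_truncKernel_mul_le hN.le hM0
      fun x t hx ht => hM (g x, t) (memK (hgN x hx) ht)⟩
    exact hk.measurable.comp ((hgm.comp measurable_fst).prodMk measurable_snd)
  obtain ⟨S, hS, -⟩ := hex _ _ hbd'
  refine ⟨S, hS.isCompactOperator_of_finite hgm hfin, ?_⟩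
  have hdiff : ∀ x t, |truncKernel k N x t - truncKernel (fun x t => k (g x) t) N x t| *
      max |x| |t| ≤ η / (2 * (C + 1) * N) * N := fun x t => by
    have h := abs_truncKernel_mul_le (k := fun x t => k x t - k (g x) t) hN.le
      (M := η / (2 * (C + 1) * N)) (by positivity) (fun x t hx ht => by
        refine huc (x, t) (memK (by linarith) ht) (g x, t) (memK (hgN x hx) ht) ?_
        rw [Prod.dist_eq, dist_self, max_eq_left dist_nonneg]
        exact (hg x).trans (min_le_left _ _)) x t
    convert h using 3
    unfold truncKernel
    split_ifs <;> simp
  rw [dist_eq_norm]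
  calc ‖T - S‖ ≤ C * (η / (2 * (C + 1) * N) * N) := hsub _ _ _ _ _ hbd hbd' hdiff T S hT hS
    _ = η * (C / (2 * (C + 1))) := by field_simp
    _ < η * 1 := by
        gcongr
        rw [div_lt_one (by positivity)]
        linarith
    _ = η := mul_one η

/-- A continuous kernel that is `o(1 / max |x| |t|)` at infinity defines a compact operator. -/
theorem IsKernelOp.isCompactOperator {k : ℝ → ℝ → ℝ} (hk : Continuous (Function.uncurry k))
    {ε : ℝ} (hb : HardyBound k ε)
    (hinf : ∀ η > 0, ∃ N > 0, ∀ x t, N < max |x| |t| → |k x t| * max |x| |t| ≤ η)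
    {p : ℝ≥0∞} (hp1 : 1 < p) (hp2 : p ≠ ⊤) [Fact (1 ≤ p)] {T : LpR p →L[ℝ] LpR p}
    (hT : IsKernelOp k p T) : IsCompactOperator T := by
  obtain ⟨C, hC, hsub⟩ := HardyBound.exists_norm_sub_le (p := p) hp1 hp2
  suffices T ∈ closure {S : LpR p →L[ℝ] LpR p | IsCompactOperator S} by
    rwa [isClosed_setOfPred_isCompactOperator.closure_eq] at this
  rw [Metric.mem_closure_iff]
  intro η hη
  obtain ⟨N, hN, hN'⟩ := hinf (η / (2 * (C + 1))) (by positivity)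
  obtain ⟨⟨M, hM⟩, S, hS, hSc⟩ := exists_isKernelOp_truncKernel hk hN hp1 hp2
  refine ⟨S, hSc, ?_⟩
  rw [dist_eq_norm]
  have hdiff : ∀ x t, |k x t - truncKernel k N x t| * max |x| |t| ≤ η / (2 * (C + 1)) :=
    fun x t => by
      unfold truncKernel
      split_ifs with h
      · simp; positivity
      · rw [sub_zero]
        exact hN' x t (by rwa [← max_le_iff, not_le] at h)
  calc ‖T - S‖ ≤ C * (η / (2 * (C + 1))) := hsub _ _ _ _ _ hb hM hdiff T S hT hS
    _ = η * (C / (2 * (C + 1))) := by ring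
    _ < η * 1 := by
        gcongr
        rw [div_lt_one (by positivity)]
        linarith
    _ = η := mul_one η

theorem mul_le_sub_of_increment_le {f g A : ℝ → ℝ} {L : ℝ} (hf0 : ∀ x, 0 < f x)
    (hg0 : ∀ x, 0 < g x) (hf : Antitone f)
    (hfA : ∀ x y, x ≤ y → (f x - f y) * g x ≤ A y - A x)
    (hgA : ∀ x y, x ≤ y → (g y - g x) * f y ≤ A y - A x)
    (hA : ∀ x, A x ≤ L) (hfg : Tendsto (fun x => f x / g x) atTop (𝓝 0)) (x : ℝ) :
    f x * g x ≤ L - A x := by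
  have hsq : Tendsto (fun y => f y ^ 2) atTop (𝓝 0) := by
    refine squeeze_zero' (.of_forall fun y => sq_nonneg _) ?_
      (by simpa using hfg.mul_const (L - A 0 + g 0 * f 0))
    filter_upwards [eventually_ge_atTop 0] with y hy
    have h1 := hgA 0 y hy
    have h2 := mul_le_mul_of_nonneg_left (hf hy) (hg0 0).le
    have h3 : g y * f y ≤ L - A 0 + g 0 * f 0 := by linarith [hA y]
    calc f y ^ 2 = f y / g y * (g y * f y) := by have := (hg0 y).ne'; field_simp
      _ ≤ _ := mul_le_mul_of_nonneg_left h3 (div_pos (hf0 y) (hg0 y)).le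
  have hlim : Tendsto f atTop (𝓝 0) := by
    have := hsq.sqrt
    simpa [Real.sqrt_sq (hf0 _).le] using this
  have h : Tendsto (fun y => (f x - f y) * g x) atTop (𝓝 ((f x - 0) * g x)) :=
    (hlim.const_sub _).mul_const _
  rw [sub_zero] at h
  refine le_of_tendsto h ?_
  filter_upwards [eventually_ge_atTop x] with y hy
  linarith [hfA x y hy, hA y]

namespace PFSS

variable {r q u v u' v' : ℝ → ℝ}

theorem continuous_u (h : PFSS r q u v u' v') : Continuous u := by
  have : u = fun b => u 0 + ∫ t in (0 : ℝ)..b, u' t := by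
    ext b; rw [← h.u_deriv]; ring
  rw [this]
  exact continuous_const.add (intervalIntegral.continuous_primitive h.u'_intble 0)

theorem continuous_v (h : PFSS r q u v u' v') : Continuous v := by
  have : v = fun b => v 0 + ∫ t in (0 : ℝ)..b, v' t := by
    ext b; rw [← h.v_deriv]; ring
  rw [this]
  exact continuous_const.add (intervalIntegral.continuous_primitive h.v'_intble 0)

theorem antitone_u (h : PFSS r q u v u' v') : Antitone u := fun a b hab => by
  have h1 := h.u_deriv a b
  have h2 := intervalIntegral.integral_nonneg (f := fun t => -u' t) (μ := volume) hab
    fun t _ => neg_nonneg.2 (h.u'_nonpos t)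
  rw [intervalIntegral.integral_neg] at h2
  linarith

theorem monotone_v (h : PFSS r q u v u' v') : Monotone v := fun a b hab => by
  have h1 := h.v_deriv a b
  have h2 := intervalIntegral.integral_nonneg (f := v') (μ := volume) hab
    fun t _ => h.v'_nonneg t
  linarith

theorem neg_deriv_mul_le (h : PFSS r q u v u' v') (hr : ∀ x, 0 < r x) (x : ℝ) :
    -u' x * v x ≤ 1 / r x := by
  rw [le_div_iff₀ (hr x), ← h.wronskian x]
  have := mul_nonneg (hr x).le (mul_nonneg (h.v'_nonneg x) (h.u_pos x).le)
  linarith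

theorem deriv_mul_le (h : PFSS r q u v u' v') (hr : ∀ x, 0 < r x) (x : ℝ) :
    v' x * u x ≤ 1 / r x := by
  rw [le_div_iff₀ (hr x), ← h.wronskian x]
  have := mul_nonneg (hr x).le (mul_nonneg (neg_nonneg.2 (h.u'_nonpos x)) (h.v_pos x).le)
  linarith

theorem sub_mul_le (h : PFSS r q u v u' v') (hr : ∀ x, 0 < r x)
    (hrL1 : Integrable fun t => 1 / r t) {x y : ℝ} (hxy : x ≤ y) :
    (u x - u y) * v x ≤ ∫ t in x..y, 1 / r t := by
  have e : (u x - u y) * v x = ∫ t in x..y, -u' t * v x := by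
    rw [intervalIntegral.integral_mul_const, intervalIntegral.integral_neg, ← h.u_deriv]
    ring
  rw [e]
  refine intervalIntegral.integral_mono_on hxy ((h.u'_intble x y).neg.mul_const _)
    hrL1.intervalIntegrable fun t ht => ?_
  exact (mul_le_mul_of_nonneg_left (h.monotone_v ht.1) (neg_nonneg.2 (h.u'_nonpos t))).trans
    (h.neg_deriv_mul_le hr t)

theorem sub_mul_le' (h : PFSS r q u v u' v') (hr : ∀ x, 0 < r x)
    (hrL1 : Integrable fun t => 1 / r t) {x y : ℝ} (hxy : x ≤ y) :
    (v y - v x) * u y ≤ ∫ t in x..y, 1 / r t := by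
  rw [h.v_deriv, ← intervalIntegral.integral_mul_const]
  refine intervalIntegral.integral_mono_on hxy ((h.v'_intble x y).mul_const _)
    hrL1.intervalIntegrable fun t ht => ?_
  exact (mul_le_mul_of_nonneg_left (h.antitone_u ht.2) (h.v'_nonneg t)).trans
    (h.deriv_mul_le hr t)

theorem mul_le_integral_Ici (h : PFSS r q u v u' v') (hr : ∀ x, 0 < r x)
    (hrL1 : Integrable fun t => 1 / r t) (x : ℝ) :
    u x * v x ≤ ∫ t in Set.Ici x, 1 / r t := by
  have hadd := intervalIntegral.integral_Iic_add_Ioi (b := x) hrL1.integrableOn hrL1.integrableOn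
  rw [integral_Ici_eq_integral_Ioi, ← sub_eq_of_eq_add' hadd.symm]
  refine mul_le_sub_of_increment_le (A := fun x => ∫ t in Set.Iic x, 1 / r t) h.u_pos h.v_pos
    h.antitone_u ?_ ?_ ?_ h.ratio_top x
  · intro x y hxy
    rw [intervalIntegral.integral_Iic_sub_Iic hrL1.integrableOn hrL1.integrableOn]
    exact h.sub_mul_le hr hrL1 hxy
  · intro x y hxy
    rw [intervalIntegral.integral_Iic_sub_Iic hrL1.integrableOn hrL1.integrableOn]
    exact h.sub_mul_le' hr hrL1 hxy
  · exact fun x => setIntegral_le_integral hrL1 (.of_forall fun t => (one_div_pos.2 (hr t)).le)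

theorem mul_le_integral_Iic (h : PFSS r q u v u' v') (hr : ∀ x, 0 < r x)
    (hrL1 : Integrable fun t => 1 / r t) (x : ℝ) :
    u x * v x ≤ ∫ t in Set.Iic x, 1 / r t := by
  have key := mul_le_sub_of_increment_le (f := fun x => v (-x)) (g := fun x => u (-x)) (L := 0)
    (A := fun x => -∫ t in Set.Iic (-x), 1 / r t) (fun _ => h.v_pos _) (fun _ => h.u_pos _)
    (fun _ _ hxy => h.monotone_v (neg_le_neg hxy)) ?_ ?_ ?_
    (h.ratio_bot.comp tendsto_neg_atTop_atBot) (-x)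
  · simpa [mul_comm] using key
  · intro x y hxy
    rw [neg_sub_neg, intervalIntegral.integral_Iic_sub_Iic hrL1.integrableOn hrL1.integrableOn]
    exact h.sub_mul_le' hr hrL1 (neg_le_neg hxy)
  · intro x y hxy
    rw [neg_sub_neg, intervalIntegral.integral_Iic_sub_Iic hrL1.integrableOn hrL1.integrableOn]
    exact h.sub_mul_le hr hrL1 (neg_le_neg hxy)
  · exact fun x => neg_nonpos.2 (integral_nonneg fun t => (one_div_pos.2 (hr t)).le)

theorem continuous_greenKernel (h : PFSS r q u v u' v') :
    Continuous (Function.uncurry (greenKernel u v)) := by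
  have : Function.uncurry (greenKernel u v) =
      fun z : ℝ × ℝ => u (max z.1 z.2) * v (min z.1 z.2) := by
    ext ⟨x, t⟩
    simp only [Function.uncurry, greenKernel]
    split_ifs with hx
    · rw [max_eq_left hx, min_eq_right hx]
    · rw [max_eq_right (not_le.1 hx).le, min_eq_left (not_le.1 hx).le]
  rw [this]
  have := h.continuous_u
  have := h.continuous_v
  fun_prop

theorem greenKernel_nonneg (h : PFSS r q u v u' v') (x t : ℝ) : 0 ≤ greenKernel u v x t := by
  unfold greenKernel
  split_ifs <;> exact (mul_pos (h.u_pos _) (h.v_pos _)).le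

end PFSS

theorem greenKernel_comm (u v : ℝ → ℝ) (x t : ℝ) :
    greenKernel u v x t = greenKernel u v t x := by
  rcases lt_trichotomy x t with hx | rfl | hx
  · simp [greenKernel, hx.le, hx.not_ge]
  · rfl
  · simp [greenKernel, hx.le, hx.not_ge]

/-- The Green kernel at `(x, t)` is controlled by the products of the tails of `1 / r` at
whichever of `x`, `t` is larger in absolute value. -/
theorem PFSS.exists_greenKernel_mul_le {r q u v u' v' : ℝ → ℝ} (h : PFSS r q u v u' v')
    (hr : ∀ x, 0 < r x) (hrL1 : Integrable fun t => 1 / r t) :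
    ∃ κ > 0, ∀ x t, ∃ y, |y| = max |x| |t| ∧ κ * (|greenKernel u v x t| * max |x| |t|) ≤
      |y| * (∫ s in Set.Iic y, 1 / r s) * ∫ s in Set.Ici y, 1 / r s := by
  have hnn : ∀ t, 0 ≤ 1 / r t := fun t => (one_div_pos.2 (hr t)).le
  have hsupp : Function.support (fun t => 1 / r t) = Set.univ := by
    ext t; simpa using (hr t).ne'
  set P : ℝ → ℝ := fun x => ∫ s in Set.Iic x, 1 / r s with hP
  set Q : ℝ → ℝ := fun x => ∫ s in Set.Ici x, 1 / r s with hQ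
  have hP0 : 0 < P 0 := by
    rw [hP, setIntegral_pos_iff_support_of_nonneg_ae (.of_forall hnn) hrL1.integrableOn, hsupp]
    simp
  have hQ0 : 0 < Q 0 := by
    rw [hQ, setIntegral_pos_iff_support_of_nonneg_ae (.of_forall hnn) hrL1.integrableOn, hsupp]
    simp
  have hPm : Monotone P := fun a b hab => setIntegral_mono_set hrL1.integrableOn (.of_forall hnn)
    (Set.Iic_subset_Iic.2 hab).eventuallyLE
  have hQm : Antitone Q := fun a b hab => setIntegral_mono_set hrL1.integrableOn (.of_forall hnn)
    (Set.Ici_subset_Ici.2 hab).eventuallyLE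
  have hPn : ∀ x, 0 ≤ P x := fun x => integral_nonneg hnn
  have hQn : ∀ x, 0 ≤ Q x := fun x => integral_nonneg hnn
  refine ⟨min (P 0) (Q 0), lt_min hP0 hQ0, ?_⟩
  have main : ∀ x t, t ≤ x → ∃ y, |y| = max |x| |t| ∧
      min (P 0) (Q 0) * (|greenKernel u v x t| * max |x| |t|) ≤ |y| * P y * Q y := by
    intro x t htx
    have hG : greenKernel u v x t = u x * v t := if_pos htx
    have hGQ : greenKernel u v x t ≤ Q x := hG.trans_le <|
      (mul_le_mul_of_nonneg_left (h.monotone_v htx) (h.u_pos x).le).trans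
        (h.mul_le_integral_Ici hr hrL1 x)
    have hGP : greenKernel u v x t ≤ P t := hG.trans_le <|
      (mul_le_mul_of_nonneg_right (h.antitone_u htx) (h.v_pos t).le).trans
        (h.mul_le_integral_Iic hr hrL1 t)
    have hGn := h.greenKernel_nonneg x t
    rw [abs_of_nonneg hGn]
    by_cases hc : 0 ≤ x ∧ |t| ≤ |x|
    · refine ⟨x, (max_eq_left hc.2).symm, ?_⟩
      rw [max_eq_left hc.2]
      calc min (P 0) (Q 0) * (greenKernel u v x t * |x|) ≤ P x * (Q x * |x|) := by
            gcongr
            · exact hPn x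
            · exact (min_le_left _ _).trans (hPm hc.1)
        _ = _ := by ring
    · have ht : t ≤ 0 ∧ |x| ≤ |t| := by
        by_cases hx : 0 ≤ x
        · have hlt : |x| < |t| := not_le.1 fun h' => hc ⟨hx, h'⟩
          refine ⟨le_of_not_gt fun ht => ?_, hlt.le⟩
          rw [abs_of_pos ht, abs_of_nonneg hx] at hlt
          linarith
        · have hx := (not_le.1 hx).le
          exact ⟨htx.trans hx, abs_le_abs_of_nonpos hx htx⟩
      refine ⟨t, (max_eq_right ht.2).symm, ?_⟩
      rw [max_eq_right ht.2]
      calc min (P 0) (Q 0) * (greenKernel u v x t * |t|) ≤ Q t * (P t * |t|) := by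
            gcongr
            · exact hQn t
            · exact (min_le_right _ _).trans (hQm ht.1)
        _ = _ := by ring
  intro x t
  rcases le_total t x with htx | hxt
  · exact main x t htx
  · rw [greenKernel_comm, max_comm]
    exact main t x hxt

/-- **Theorem 3.13.** Assume (1.2), (2.1) and `1/r ∈ L₁(ℝ)`, and let `u, v` be
a principal FSS.  With `θ(x) = |x| (∫_{-∞}^x dt/r)(∫_x^∞ dt/r)`: if
`sup θ < ∞` then for every `p ∈ (1,∞)` the Green operator is bounded on
`L_p(ℝ)`; if moreover `θ(x) → 0` as `|x| → ∞`, then it is compact. -/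
theorem green_bounded_compact_of_theta
    (r q u v u' v' : ℝ → ℝ) (p : ℝ≥0∞) (hp1 : 1 < p) (hp2 : p ≠ ⊤)
    [Fact (1 ≤ p)]
    (h12 : Cond12 r q) (h21 : Cond21 q)
    (hrL1 : Integrable (fun t => 1 / r t) volume)
    (hfss : PFSS r q u v u' v')
    (θ : ℝ → ℝ)
    (hθ : ∀ x : ℝ, θ x = |x| * (∫ t in Set.Iic x, 1 / r t) * ∫ t in Set.Ici x, 1 / r t)
    (hθbdd : BddAbove (Set.range θ)) :
    (∃ G : LpR p →L[ℝ] LpR p, IsGreenOp u v p G) ∧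
      (Tendsto θ (cocompact ℝ) (𝓝 0) →
        ∃ G : LpR p →L[ℝ] LpR p, IsGreenOp u v p G ∧ IsCompactOperator G) := by
  obtain ⟨-, -, hr, -⟩ := h12
  obtain ⟨κ, hκ, hG⟩ := hfss.exists_greenKernel_mul_le hr hrL1
  simp_rw [← hθ] at hG
  obtain ⟨B, hB⟩ := hθbdd
  have hbd : HardyBound (greenKernel u v) (B / κ) := by
    refine ⟨hfss.continuous_greenKernel.measurable, fun x t => ?_⟩
    obtain ⟨y, -, hy⟩ := hG x t
    rw [le_div_iff₀' hκ]
    exact hy.trans (hB ⟨y, rfl⟩)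
  obtain ⟨C, -, hC⟩ := HardyBound.exists_isKernelOp (p := p) hp1 hp2
  obtain ⟨G, hGop, -⟩ := hC _ _ hbd
  refine ⟨⟨G, hGop⟩, fun hlim => ⟨G, hGop, ?_⟩⟩
  refine IsKernelOp.isCompactOperator hfss.continuous_greenKernel hbd (fun η hη => ?_) hp1 hp2 hGop
  have hev := hlim.eventually (gt_mem_nhds (mul_pos hκ hη))
  rw [← Metric.cobounded_eq_cocompact, hasBasis_cobounded_norm.eventually_iff] at hev
  obtain ⟨N, -, hN⟩ := hev
  refine ⟨max N 1, by positivity, fun x t hxt => ?_⟩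
  obtain ⟨y, hy, hle⟩ := hG x t
  have hyN : N ≤ ‖y‖ := by
    rw [Real.norm_eq_abs, hy]
    exact (le_max_left _ _).trans hxt.le
  exact le_of_mul_le_mul_left (hle.trans (hN hyN).le) hκ
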